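/- arXiv:2311.11075 — 2 statements merged into one kernel-verified Lean document; each statement's English description precedes it below -/
import Mathlib

section
/- Let E and F be finite-dimensional real inner product spaces with dim E = m, let f : E → F be a linear map with singular values λ_1(f) ≥ ⋯ ≥ λ_m(f), and let 1 ≤ k ≤ m. Then for any orthonormal vectors a_1, …, a_k in E and any orthonormal vectors b_1, …, b_k in F, one has ∑_{i=1}^k ⟨f(a_i), b_i⟩ ≤ ∑_{i=1}^k λ_i(f). -/
open RealInnerProductSpace

/-- `lam : Fin m → ℝ` is the (descending) sequence of singular values of the linear map
`f : E → F`, i.e. the `lam i` are nonnegative, arranged in descending order, and the squares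
`lam i ^ 2` are the eigenvalues of `fᵀ ∘ f` with respect to some orthonormal eigenbasis. -/
def IsSingularValues {m : ℕ} {E F : Type*} [NormedAddCommGroup E] [InnerProductSpace ℝ E]
    [NormedAddCommGroup F] [InnerProductSpace ℝ F] [FiniteDimensional ℝ E]
    [FiniteDimensional ℝ F] (f : E →ₗ[ℝ] F) (lam : Fin m → ℝ) : Prop :=
  Antitone lam ∧ (∀ i, 0 ≤ lam i) ∧
    ∃ a : OrthonormalBasis (Fin m) ℝ E,
      ∀ i, LinearMap.adjoint f (f (a i)) = lam i ^ 2 • a i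

/-- Bessel's inequality for a finite orthogonal family of vectors of norm at most one. -/
theorem sum_inner_sq_le_of_pairwise_orthogonal {ι F : Type*} [Fintype ι] [NormedAddCommGroup F]
    [InnerProductSpace ℝ F] (u : ι → F) (hu : Pairwise fun i j => ⟪u i, u j⟫ = 0)
    (hu1 : ∀ i, ‖u i‖ ≤ 1) (x : F) : ∑ i, ⟪u i, x⟫ ^ 2 ≤ ‖x‖ ^ 2 := by
  have hcross : ⟪x, ∑ i, ⟪u i, x⟫ • u i⟫ = ∑ i, ⟪u i, x⟫ ^ 2 := by
    rw [inner_sum]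
    refine Finset.sum_congr rfl fun i _ => ?_
    rw [real_inner_smul_right, real_inner_comm, sq]
  have hnorm : ‖∑ i, ⟪u i, x⟫ • u i‖ ^ 2 ≤ ∑ i, ⟪u i, x⟫ ^ 2 := by
    rw [← real_inner_self_eq_norm_sq, sum_inner]
    refine Finset.sum_le_sum fun i _ => ?_
    rw [inner_sum, Finset.sum_eq_single i]
    · rw [real_inner_smul_left, real_inner_smul_right, real_inner_self_eq_norm_sq, ← mul_assoc,
        ← sq]
      exact mul_le_of_le_one_right (sq_nonneg _) (pow_le_one₀ (norm_nonneg _) (hu1 i))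
    · intro j _ hj
      rw [real_inner_smul_left, real_inner_smul_right, hu hj.symm, mul_zero, mul_zero]
    · simp
  have h := norm_sub_sq_real x (∑ i, ⟪u i, x⟫ • u i)
  nlinarith [sq_nonneg ‖x - ∑ i, ⟪u i, x⟫ • u i‖]

/-- A weighted sum of a nonnegative descending sequence, with weights in `[0, 1]` of total at most
`k`, is at most the sum of its first `k` terms. -/
theorem sum_mul_le_sum_castLE {m k : ℕ} (hk : 1 ≤ k) (hkm : k ≤ m) {lam p : Fin m → ℝ}
    (hanti : Antitone lam) (hnonneg : ∀ i, 0 ≤ lam i) (hp0 : ∀ i, 0 ≤ p i) (hp1 : ∀ i, p i ≤ 1)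
    (hpk : ∑ i, p i ≤ k) : ∑ i, lam i * p i ≤ ∑ i : Fin k, lam (Fin.castLE hkm i) := by
  obtain ⟨d, rfl⟩ := Nat.exists_eq_add_of_le hkm
  set c := lam ⟨k - 1, by omega⟩ with hc
  have hhead : ∑ i : Fin k, (lam (Fin.castAdd d i) - c) * p (Fin.castAdd d i) ≤
      ∑ i : Fin k, (lam (Fin.castAdd d i) - c) := by
    refine Finset.sum_le_sum fun i _ => mul_le_of_le_one_right ?_ (hp1 _)
    refine sub_nonneg.2 (hanti ?_)
    simp only [Fin.le_def, Fin.val_castAdd]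
    omega
  have htail : ∑ i : Fin d, (lam (Fin.natAdd k i) - c) * p (Fin.natAdd k i) ≤ 0 := by
    refine Finset.sum_nonpos fun i _ => mul_nonpos_of_nonpos_of_nonneg ?_ (hp0 _)
    refine sub_nonpos.2 (hanti ?_)
    simp only [Fin.le_def, Fin.val_natAdd]
    omega
  have hsplit : ∑ i, lam i * p i = ∑ i, (lam i - c) * p i + c * ∑ i, p i := by
    rw [Finset.mul_sum, ← Finset.sum_add_distrib]
    exact Finset.sum_congr rfl fun i _ => by ring
  rw [hsplit, Fin.sum_univ_add (fun i => (lam i - c) * p i)]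
  have hck : c * ∑ i, p i ≤ c * k := mul_le_mul_of_nonneg_left hpk (hnonneg _)
  simp only [Finset.sum_sub_distrib, Finset.sum_const, Finset.card_univ, Fintype.card_fin,
    nsmul_eq_mul] at hhead
  change _ ≤ ∑ i : Fin k, lam (Fin.castAdd d i)
  linarith

/-- Left singular vectors: the image of the eigenbasis is `lam` times an orthogonal family of
vectors of norm at most one. -/
theorem exists_left_singular_vectors {m : ℕ} {E F : Type*} [NormedAddCommGroup E]
    [InnerProductSpace ℝ E] [NormedAddCommGroup F] [InnerProductSpace ℝ F]
    [FiniteDimensional ℝ E] [FiniteDimensional ℝ F] (f : E →ₗ[ℝ] F) (lam : Fin m → ℝ)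
    (e : OrthonormalBasis (Fin m) ℝ E)
    (he : ∀ i, LinearMap.adjoint f (f (e i)) = lam i ^ 2 • e i) :
    ∃ u : Fin m → F, (∀ i, f (e i) = lam i • u i) ∧ (Pairwise fun i j => ⟪u i, u j⟫ = 0) ∧
      ∀ i, ‖u i‖ ≤ 1 := by
  have hinner (i j : Fin m) : ⟪f (e i), f (e j)⟫ = lam i ^ 2 * ⟪e i, e j⟫ := by
    rw [← LinearMap.adjoint_inner_left, he, real_inner_smul_left]
  have hnorm (i : Fin m) : ‖f (e i)‖ = |lam i| := by
    rw [← sq_eq_sq₀ (norm_nonneg _) (abs_nonneg _), ← real_inner_self_eq_norm_sq, hinner,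
      real_inner_self_eq_norm_sq, e.norm_eq_one, sq_abs]
    ring
  refine ⟨fun i => (lam i)⁻¹ • f (e i), fun i => ?_, fun i j hij => ?_, fun i => ?_⟩
  · by_cases hi : lam i = 0
    · have : f (e i) = 0 := by rw [← norm_eq_zero, hnorm, hi, abs_zero]
      simp [this]
    · rw [smul_inv_smul₀ hi]
  · simp only [real_inner_smul_left, real_inner_smul_right, hinner, e.inner_eq_zero hij, mul_zero]
  · rw [norm_smul, hnorm, norm_inv, Real.norm_eq_abs]
    exact inv_mul_le_one

theorem stmt0 {m : ℕ} {E F : Type*} [NormedAddCommGroup E] [InnerProductSpace ℝ E]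
    [NormedAddCommGroup F] [InnerProductSpace ℝ F] [FiniteDimensional ℝ E]
    [FiniteDimensional ℝ F] (hE : Module.finrank ℝ E = m)
    (f : E →ₗ[ℝ] F) (lam : Fin m → ℝ) (hlam : IsSingularValues f lam)
    (k : ℕ) (hk1 : 1 ≤ k) (hkm : k ≤ m)
    (a : Fin k → E) (ha : Orthonormal ℝ a)
    (b : Fin k → F) (hb : Orthonormal ℝ b) :
    ∑ i : Fin k, ⟪f (a i), b i⟫ ≤ ∑ i : Fin k, lam (Fin.castLE hkm i) := by
  obtain ⟨hanti, hnonneg, e, he⟩ := hlam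
  obtain ⟨u, hfu, huo, hu1⟩ := exists_left_singular_vectors f lam e he
  have hexp (i : Fin k) : ⟪f (a i), b i⟫ = ∑ j, lam j * (⟪a i, e j⟫ * ⟪u j, b i⟫) := by
    conv_lhs => rw [← e.sum_repr' (a i), map_sum, sum_inner]
    refine Finset.sum_congr rfl fun j _ => ?_
    rw [map_smul, hfu, real_inner_smul_left, real_inner_smul_left, real_inner_comm]
    ring
  have hle : ∑ i, ⟪f (a i), b i⟫ ≤
      ∑ j, lam j * ((∑ i, ⟪a i, e j⟫ ^ 2 + ∑ i, ⟪b i, u j⟫ ^ 2) / 2) := by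
    simp only [hexp]
    rw [Finset.sum_comm]
    refine Finset.sum_le_sum fun j _ => ?_
    rw [← Finset.mul_sum, ← Finset.sum_add_distrib, Finset.sum_div]
    refine mul_le_mul_of_nonneg_left (Finset.sum_le_sum fun i _ => ?_) (hnonneg j)
    rw [real_inner_comm (b i) (u j)]
    nlinarith [sq_nonneg (⟪a i, e j⟫ - ⟪b i, u j⟫)]
  refine hle.trans (sum_mul_le_sum_castLE hk1 hkm hanti hnonneg (fun j => by positivity) ?_ ?_)
  · intro j
    have h1 := sum_inner_sq_le_of_pairwise_orthogonal a ha.2 (fun i => (ha.1 i).le) (e j)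
    have h2 := sum_inner_sq_le_of_pairwise_orthogonal b hb.2 (fun i => (hb.1 i).le) (u j)
    have h3 : ‖u j‖ ^ 2 ≤ 1 := pow_le_one₀ (norm_nonneg _) (hu1 j)
    rw [e.norm_eq_one, one_pow] at h1
    linarith
  · have h1 : ∑ j, ∑ i, ⟪a i, e j⟫ ^ 2 ≤ k := by
      rw [Finset.sum_comm]
      refine (Finset.sum_le_card_nsmul _ _ 1 fun i _ => ?_).trans_eq (by simp)
      have h := sum_inner_sq_le_of_pairwise_orthogonal e e.orthonormal.2
        (fun j => (e.norm_eq_one j).le) (a i)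
      simpa only [real_inner_comm, ha.1 i, one_pow] using h
    have h2 : ∑ j, ∑ i, ⟪b i, u j⟫ ^ 2 ≤ k := by
      rw [Finset.sum_comm]
      refine (Finset.sum_le_card_nsmul _ _ 1 fun i _ => ?_).trans_eq (by simp)
      have h := sum_inner_sq_le_of_pairwise_orthogonal u huo hu1 (b i)
      simpa only [real_inner_comm, hb.1 i, one_pow] using h
    rw [← Finset.sum_div, Finset.sum_add_distrib]
    linarith
end

section
/- Let x, y ∈ ℝ satisfy x > 1, 0 < y < 1, and x + y ≤ 2. Then y/(1−y²)² < x/(1−x²)²; equivalently, the function s ↦ 1/(1−(x−s)²) + 1/(1−(y+s)²) has strictly negative derivative at s = 0. -/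
theorem div_one_sub_sq_sq_lt {x y : ℝ} (hx : 1 < x) (hy0 : 0 < y) (hy1 : y < 1)
    (hxy : x + y ≤ 2) : y / (1 - y ^ 2) ^ 2 < x / (1 - x ^ 2) ^ 2 := by
  have hx2 : 1 - x ^ 2 ≠ 0 := by nlinarith
  have hy2 : 1 - y ^ 2 ≠ 0 := by nlinarith
  rw [div_lt_div_iff₀ (by positivity) (by positivity)]
  have hprod : x * y < 1 := by nlinarith [mul_pos (sub_pos.2 hx) (sub_pos.2 hy1)]
  have hplus : y * (1 + x) ^ 2 < x * (1 + y) ^ 2 := by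
    nlinarith [mul_pos (sub_pos.2 (hy1.trans hx)) (sub_pos.2 hprod)]
  have hminus : (x - 1) ^ 2 ≤ (1 - y) ^ 2 :=
    pow_le_pow_left₀ (by linarith) (by linarith) 2
  calc y * (1 - x ^ 2) ^ 2 = y * (1 + x) ^ 2 * (x - 1) ^ 2 := by ring
    _ < x * (1 + y) ^ 2 * (x - 1) ^ 2 :=
      mul_lt_mul_of_pos_right hplus (pow_pos (sub_pos.2 hx) 2)
    _ ≤ x * (1 + y) ^ 2 * (1 - y) ^ 2 :=
      mul_le_mul_of_nonneg_left hminus (by positivity)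
    _ = x * (1 - y ^ 2) ^ 2 := by ring

theorem hasDerivAt_one_div_one_sub_sq {t : ℝ} (ht : 1 - t ^ 2 ≠ 0) :
    HasDerivAt (fun u : ℝ => 1 / (1 - u ^ 2)) (2 * (t / (1 - t ^ 2) ^ 2)) t := by
  have h := ((hasDerivAt_pow 2 t).const_sub 1).fun_inv ht
  simp only [one_div]
  refine h.congr_deriv ?_
  push_cast
  ring

theorem stmt8 (x y : ℝ) (hx : 1 < x) (hy0 : 0 < y) (hy1 : y < 1) (hxy : x + y ≤ 2) :
    y / (1 - y ^ 2) ^ 2 < x / (1 - x ^ 2) ^ 2 ∧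
      deriv (fun s : ℝ => 1 / (1 - (x - s) ^ 2) + 1 / (1 - (y + s) ^ 2)) 0 < 0 := by
  have hlt := div_one_sub_sq_sq_lt hx hy0 hy1 hxy
  refine ⟨hlt, ?_⟩
  have hx2 : 1 - (x - 0) ^ 2 ≠ 0 := by nlinarith
  have hy2 : 1 - (y + 0) ^ 2 ≠ 0 := by nlinarith
  have hderiv := ((hasDerivAt_one_div_one_sub_sq hx2).comp_const_sub x 0).fun_add
    ((hasDerivAt_one_div_one_sub_sq hy2).comp_const_add y 0)
  rw [HasDerivAt.deriv hderiv, sub_zero, add_zero]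
  linarith
end
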